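/- arXiv:2408.04351 — 6 statements merged into one kernel-verified Lean document; each statement's English description precedes it below -/
import Mathlib

section
/- Let 0 < α < 1 and let f : ℝ → ℝ be continuously differentiable on [0,∞) with f and f′ bounded by a·e^{bt} for some constants a ≥ 0, b ≥ 0. Then for every real s > b, the Laplace transform of the Caputo fractional derivative of f satisfies ∫₀^∞ e^{−st} (^C D^α f)(t) dt = s^α·F(s) − s^{α−1}·f(0), where F(s) = ∫₀^∞ e^{−st} f(t) dt. -/
open MeasureTheory

/-- The Caputo fractional derivative of order `α ∈ (0,1)`, expressed in terms of the
derivative `f'` of `f`: `^C D^α f(t) = (1/Γ(1−α)) ∫₀^t f′(s)·(t−s)^{−α} ds`. -/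
noncomputable def caputoDeriv (α : ℝ) (f' : ℝ → ℝ) (t : ℝ) : ℝ :=
  (1 / Real.Gamma (1 - α)) * ∫ s in (0 : ℝ)..t, f' s * (t - s) ^ (-α)

/-- A function on `[0,∞)` dominated by `a·e^{bt}` has an absolutely convergent Laplace integral
at every `s > b`. -/
lemma integrableOn_exp_neg_mul_of_abs_le_exp {g : ℝ → ℝ} {a b s : ℝ}
    (hg : ContinuousOn g (Set.Ici 0))
    (hgb : ∀ t : ℝ, 0 ≤ t → |g t| ≤ a * Real.exp (b * t)) (hs : b < s) :
    IntegrableOn (fun t => Real.exp (-(s * t)) * g t) (Set.Ioi 0) := by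
  have hint : IntegrableOn (fun t : ℝ => a * Real.exp (-(s - b) * t)) (Set.Ioi 0) :=
    (exp_neg_integrableOn_Ioi 0 (sub_pos.2 hs)).const_mul a
  refine Integrable.mono' hint ?_ ?_
  · refine ContinuousOn.aestronglyMeasurable ?_ measurableSet_Ioi
    exact (by fun_prop : Continuous fun t : ℝ => Real.exp (-(s * t))).continuousOn.mul
      (hg.mono Set.Ioi_subset_Ici_self)
  · filter_upwards [ae_restrict_mem measurableSet_Ioi] with t ht
    rw [Real.norm_eq_abs, abs_mul, Real.abs_exp]
    calc Real.exp (-(s * t)) * |g t| ≤ Real.exp (-(s * t)) * (a * Real.exp (b * t)) := by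
          gcongr
          exact hgb t (le_of_lt ht)
      _ = a * Real.exp (-(s - b) * t) := by
          rw [mul_left_comm, ← Real.exp_add]
          ring_nf

/-- If `g` is dominated by `a·e^{bt}` on `[0,∞)` and `s > b`, then `e^{−st} g(t)` tends to `0`. -/
lemma tendsto_exp_neg_mul_mul_of_abs_le_exp {g : ℝ → ℝ} {a b s : ℝ}
    (hgb : ∀ t : ℝ, 0 ≤ t → |g t| ≤ a * Real.exp (b * t)) (hs : b < s) :
    Filter.Tendsto (fun t => Real.exp (-(s * t)) * g t) Filter.atTop (nhds 0) := by
  have hlim : Filter.Tendsto (fun t : ℝ => a * Real.exp (-((s - b) * t))) Filter.atTop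
      (nhds 0) := by
    have h := (Real.tendsto_exp_neg_atTop_nhds_zero.comp
      (Filter.tendsto_id.const_mul_atTop (sub_pos.2 hs))).const_mul a
    simpa using h
  refine squeeze_zero_norm' ?_ hlim
  filter_upwards [Filter.eventually_ge_atTop 0] with t ht
  rw [Real.norm_eq_abs, abs_mul, Real.abs_exp]
  calc Real.exp (-(s * t)) * |g t| ≤ Real.exp (-(s * t)) * (a * Real.exp (b * t)) := by
        gcongr
        exact hgb t ht
    _ = a * Real.exp (-((s - b) * t)) := by
        rw [mul_left_comm, ← Real.exp_add]
        ring_nf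

/-- The Laplace transform of a derivative: `L[f'](s) = s·L[f](s) − f(0)`. -/
lemma laplace_deriv {f f' : ℝ → ℝ} {a b s : ℝ}
    (hderiv : ∀ t ∈ Set.Ici (0 : ℝ), HasDerivWithinAt f (f' t) (Set.Ici (0 : ℝ)) t)
    (hcont : ContinuousOn f' (Set.Ici (0 : ℝ)))
    (hfb : ∀ t : ℝ, 0 ≤ t → |f t| ≤ a * Real.exp (b * t))
    (hf'b : ∀ t : ℝ, 0 ≤ t → |f' t| ≤ a * Real.exp (b * t)) (hs : b < s) :
    ∫ t in Set.Ioi (0 : ℝ), Real.exp (-(s * t)) * f' t =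
      s * (∫ t in Set.Ioi (0 : ℝ), Real.exp (-(s * t)) * f t) - f 0 := by
  have hfc : ContinuousOn f (Set.Ici 0) := fun t ht => (hderiv t ht).continuousWithinAt
  have hif := (integrableOn_exp_neg_mul_of_abs_le_exp hfc hfb hs).const_mul s
  have hif' := integrableOn_exp_neg_mul_of_abs_le_exp hcont hf'b hs
  have hexp : ∀ t : ℝ, HasDerivAt (fun t : ℝ => Real.exp (-(s * t)))
      (Real.exp (-(s * t)) * -s) t := fun t => by
    simpa using ((hasDerivAt_id t).const_mul s).neg.exp
  have key := integral_Ioi_of_hasDerivAt_of_tendsto (a := (0 : ℝ))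
    (f := fun t => Real.exp (-(s * t)) * f t)
    (f' := fun t => Real.exp (-(s * t)) * f' t - s * (Real.exp (-(s * t)) * f t))
    ((by fun_prop : Continuous fun t : ℝ => Real.exp (-(s * t))).continuousWithinAt.mul
      (hfc 0 Set.self_mem_Ici))
    (fun t ht => by
      have hft := (hderiv t (Set.Ioi_subset_Ici_self ht)).hasDerivAt (Ici_mem_nhds ht)
      exact ((hexp t).mul hft).congr_deriv (by ring))
    (hif'.sub hif) (tendsto_exp_neg_mul_mul_of_abs_le_exp hfb hs)
  rw [integral_sub hif' hif, integral_const_mul] at key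
  simp only [mul_zero, neg_zero, Real.exp_zero, one_mul] at key
  linarith

lemma integrableOn_exp_neg_mul_rpow {p s : ℝ} (hp : -1 < p) (hs : 0 < s) :
    IntegrableOn (fun t : ℝ => Real.exp (-(s * t)) * t ^ p) (Set.Ioi 0) := by
  refine (integrableOn_rpow_mul_exp_neg_mul_rpow hp one_pos hs).congr_fun
    (fun t _ => ?_) measurableSet_Ioi
  simp only [Real.rpow_one, neg_mul]
  ring

/-- The Laplace transform turns convolution on `[0,∞)` into multiplication. -/
lemma laplace_intervalConvolution {g k : ℝ → ℝ} {s : ℝ}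
    (hg : IntegrableOn (fun t => Real.exp (-(s * t)) * g t) (Set.Ioi 0))
    (hk : IntegrableOn (fun t => Real.exp (-(s * t)) * k t) (Set.Ioi 0)) :
    ∫ t in Set.Ioi (0 : ℝ), Real.exp (-(s * t)) * ∫ u in (0 : ℝ)..t, g u * k (t - u) =
      (∫ t in Set.Ioi (0 : ℝ), Real.exp (-(s * t)) * g t) *
        ∫ t in Set.Ioi (0 : ℝ), Real.exp (-(s * t)) * k t := by
  have h := integral_posConvolution hg hk (ContinuousLinearMap.mul ℝ ℝ)
  simp only [ContinuousLinearMap.mul_apply'] at h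
  rw [← h]
  congr 1 with t
  rw [← intervalIntegral.integral_const_mul]
  congr 1 with u
  rw [show -(s * t) = -(s * u) + -(s * (t - u)) by ring, Real.exp_add]
  ring

/-- Laplace transform of the Caputo derivative: for `0 < α < 1`, `f` continuously
differentiable on `[0,∞)` with `f, f′` bounded by `a·e^{bt}`, and every real `s > b`,
`∫₀^∞ e^{−st} (^C D^α f)(t) dt = s^α·F(s) − s^{α−1}·f(0)` with
`F(s) = ∫₀^∞ e^{−st} f(t) dt`. -/
theorem laplace_caputoDeriv (α : ℝ) (hα0 : 0 < α) (hα1 : α < 1) (f f' : ℝ → ℝ)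
    (hderiv : ∀ t ∈ Set.Ici (0 : ℝ), HasDerivWithinAt f (f' t) (Set.Ici (0 : ℝ)) t)
    (hcont : ContinuousOn f' (Set.Ici (0 : ℝ)))
    (a b : ℝ) (ha : 0 ≤ a) (hb : 0 ≤ b)
    (hfb : ∀ t : ℝ, 0 ≤ t → |f t| ≤ a * Real.exp (b * t))
    (hf'b : ∀ t : ℝ, 0 ≤ t → |f' t| ≤ a * Real.exp (b * t))
    (s : ℝ) (hs : b < s) :
    ∫ t in Set.Ioi (0 : ℝ), Real.exp (-(s * t)) * caputoDeriv α f' t =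
      s ^ α * (∫ t in Set.Ioi (0 : ℝ), Real.exp (-(s * t)) * f t) - s ^ (α - 1) * f 0 := by
  have hs0 : 0 < s := hb.trans_lt hs
  have hconv := laplace_intervalConvolution (k := fun t => t ^ (-α))
    (integrableOn_exp_neg_mul_of_abs_le_exp hcont hf'b hs)
    (integrableOn_exp_neg_mul_rpow (by linarith) hs0)
  have hpow : ∫ t in Set.Ioi (0 : ℝ), Real.exp (-(s * t)) * t ^ (-α) =
      s ^ (α - 1) * Real.Gamma (1 - α) := by
    have h := Real.integral_rpow_mul_exp_neg_mul_Ioi (sub_pos.2 hα1) hs0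
    rw [one_div, Real.inv_rpow hs0.le, ← Real.rpow_neg hs0.le, neg_sub,
      show 1 - α - 1 = -α by ring] at h
    simpa only [mul_comm] using h
  have hΓ : Real.Gamma (1 - α) ≠ 0 := (Real.Gamma_pos_of_pos (sub_pos.2 hα1)).ne'
  have hsα : s ^ α = s ^ (α - 1) * s := by
    rw [Real.rpow_sub_one hs0.ne', div_mul_cancel₀ _ hs0.ne']
  simp only [caputoDeriv, mul_left_comm (Real.exp _) (1 / Real.Gamma (1 - α))]
  rw [integral_const_mul, hconv, hpow, laplace_deriv hderiv hcont hfb hf'b hs, hsα]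
  field_simp
end

section
/- Let 0 < α < 1, β > 0, λ > 0, and let s be a real number with s^α > λ (equivalently s > λ^{1/α}). Then ∫₀^∞ e^{−st} · t^{β−1} · E_{α,β}(−λ t^α) dt = s^{α−β}/(s^α + λ). In particular, for β = 1, ∫₀^∞ e^{−st} E_α(−λ t^α) dt = s^{α−1}/(s^α + λ). -/
open MeasureTheory

/-- The two-parameter Mittag-Leffler function `E_{α,β}(z) = ∑_{k=0}^∞ z^k/Γ(αk + β)`. -/
noncomputable def mittagLeffler (α β z : ℝ) : ℝ :=
  ∑' k : ℕ, z ^ k / Real.Gamma (α * k + β)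

/-- Each term of the Mittag-Leffler series, multiplied by `e^{-st} t^{β-1}`, is a Gamma density up
to a constant. -/
lemma exp_mul_rpow_mul_mittagLeffler_term {α β lam s t : ℝ} (ht : 0 < t) (k : ℕ) :
    Real.exp (-(s * t)) * (t ^ (β - 1) *
        ((-(lam * t ^ α)) ^ k / Real.Gamma (α * k + β))) =
      (-lam) ^ k / Real.Gamma (α * k + β) *
        (t ^ (α * k + β - 1) * Real.exp (-(s * t))) := by
  have h : t ^ (α * k + β - 1) = (t ^ α) ^ k * t ^ (β - 1) := by
    rw [add_sub_assoc, Real.rpow_add ht, Real.rpow_mul ht.le, Real.rpow_natCast]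
  rw [h, ← neg_mul lam, mul_pow]
  ring

lemma integrableOn_rpow_sub_one_mul_exp_neg_mul {a s : ℝ} (ha : 0 < a) (hs : 0 < s) :
    IntegrableOn (fun t : ℝ => t ^ (a - 1) * Real.exp (-(s * t))) (Set.Ioi 0) := by
  simpa [Real.rpow_one, neg_mul] using
    integrableOn_rpow_mul_exp_neg_mul_rpow (s := a - 1) (by linarith) one_pos hs

lemma const_div_Gamma_mul_integral {α β s : ℝ} (hα : 0 < α) (hβ : 0 < β) (hs : 0 < s)
    (c : ℝ) (k : ℕ) :
    c ^ k / Real.Gamma (α * k + β) *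
        ∫ t in Set.Ioi (0 : ℝ), t ^ (α * k + β - 1) * Real.exp (-(s * t)) =
      (c / s ^ α) ^ k * s ^ (-β) := by
  have ha : 0 < α * k + β := by positivity
  rw [Real.integral_rpow_mul_exp_neg_mul_Ioi ha hs, one_div, Real.inv_rpow hs.le,
    Real.rpow_add hs, Real.rpow_mul hs.le, Real.rpow_natCast, Real.rpow_neg hs.le, div_pow]
  have := (Real.Gamma_pos_of_pos ha).ne'
  have := (Real.rpow_pos_of_pos hs α).ne'
  have := (Real.rpow_pos_of_pos hs β).ne'
  field_simp

lemma integral_exp_mul_rpow_mul_mittagLeffler {α β lam s : ℝ} (hα : 0 < α) (hβ : 0 < β)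
    (hlam : 0 < lam) (hs0 : 0 < s) (hs : lam < s ^ α) :
    (∫ t in Set.Ioi (0 : ℝ),
        Real.exp (-(s * t)) * (t ^ (β - 1) * mittagLeffler α β (-(lam * t ^ α)))) =
      s ^ (α - β) / (s ^ α + lam) := by
  have hsα : 0 < s ^ α := Real.rpow_pos_of_pos hs0 α
  set F : ℕ → ℝ → ℝ := fun k t => (-lam) ^ k / Real.Gamma (α * k + β) *
    (t ^ (α * k + β - 1) * Real.exp (-(s * t))) with hF
  have hFint (k : ℕ) : Integrable (F k) (volume.restrict (Set.Ioi 0)) :=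
    (integrableOn_rpow_sub_one_mul_exp_neg_mul (by positivity) hs0).const_mul _
  have hFnorm (k : ℕ) :
      ∫ t in Set.Ioi (0 : ℝ), ‖F k t‖ = (lam / s ^ α) ^ k * s ^ (-β) := by
    rw [← const_div_Gamma_mul_integral hα hβ hs0, ← integral_const_mul]
    refine setIntegral_congr_fun measurableSet_Ioi fun t ht => ?_
    have ht : 0 < t := ht
    have hΓ : 0 < Real.Gamma (α * k + β) := Real.Gamma_pos_of_pos (by positivity)
    simp only [hF, norm_mul, norm_div, norm_pow, norm_neg, Real.norm_eq_abs, abs_of_pos hlam,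
      abs_of_pos hΓ, abs_of_pos (Real.rpow_pos_of_pos ht _), Real.abs_exp]
  have hsum : Summable fun k => ∫ t in Set.Ioi (0 : ℝ), ‖F k t‖ := by
    simp_rw [hFnorm]
    exact (summable_geometric_of_lt_one (by positivity) ((div_lt_one hsα).2 hs)).mul_right _
  have hFsum := hasSum_integral_of_summable_integral_norm hFint hsum
  have hgeom : HasSum (fun k => ∫ t in Set.Ioi (0 : ℝ), F k t)
      ((1 - -lam / s ^ α)⁻¹ * s ^ (-β)) := by
    simp_rw [hF, integral_const_mul, const_div_Gamma_mul_integral hα hβ hs0]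
    refine (hasSum_geometric_of_abs_lt_one ?_).mul_right _
    rw [abs_div, abs_neg, abs_of_pos hlam, abs_of_pos hsα]
    exact (div_lt_one hsα).2 hs
  calc _ = ∫ t in Set.Ioi (0 : ℝ), ∑' k, F k t := by
        refine setIntegral_congr_fun measurableSet_Ioi fun t ht => ?_
        simp only [mittagLeffler, ← tsum_mul_left, hF]
        exact tsum_congr fun k => exp_mul_rpow_mul_mittagLeffler_term ht k
    _ = (1 - -lam / s ^ α)⁻¹ * s ^ (-β) := hFsum.unique hgeom
    _ = _ := by
        rw [sub_eq_add_neg α β, Real.rpow_add hs0]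
        have : 1 - -lam / s ^ α = (s ^ α + lam) / s ^ α := by field_simp; ring
        rw [this, inv_div]
        ring

/-- Laplace transform pairs for the Mittag-Leffler functions: for `0 < α < 1`, `β > 0`,
`λ > 0` and real `s > 0` with `s^α > λ`,
`∫₀^∞ e^{−st} t^{β−1} E_{α,β}(−λ t^α) dt = s^{α−β}/(s^α + λ)`; in particular for `β = 1`,
`∫₀^∞ e^{−st} E_α(−λ t^α) dt = s^{α−1}/(s^α + λ)`. -/
theorem laplace_mittagLeffler (α β lam s : ℝ) (hα0 : 0 < α) (hα1 : α < 1) (hβ : 0 < β)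
    (hlam : 0 < lam) (hs0 : 0 < s) (hs : lam < s ^ α) :
    (∫ t in Set.Ioi (0 : ℝ),
        Real.exp (-(s * t)) * (t ^ (β - 1) * mittagLeffler α β (-(lam * t ^ α)))) =
      s ^ (α - β) / (s ^ α + lam) ∧
    (∫ t in Set.Ioi (0 : ℝ),
        Real.exp (-(s * t)) * mittagLeffler α 1 (-(lam * t ^ α))) =
      s ^ (α - 1) / (s ^ α + lam) := by
  refine ⟨integral_exp_mul_rpow_mul_mittagLeffler hα0 hβ hlam hs0 hs, ?_⟩
  simpa using integral_exp_mul_rpow_mul_mittagLeffler hα0 one_pos hlam hs0 hs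
end

section
/- Let 0 < α < 1 and λ > 0. Then for every t > 0, the function t ↦ E_α(−λ t^α) is differentiable at t with derivative d/dt [E_α(−λ t^α)] = −λ · t^{α−1} · E_{α,α}(−λ t^α). -/
/-- For `0 < R` and `1 ≤ s`, the Gamma function satisfies `e^{-R} R^{s-1} ≤ Γ(s)`. -/
theorem Real.exp_neg_mul_rpow_le_Gamma {R s : ℝ} (hR : 0 < R) (hs : 1 ≤ s) :
    Real.exp (-R) * R ^ (s - 1) ≤ Real.Gamma s := by
  have hint := Real.GammaIntegral_convergent (zero_lt_one.trans_le hs)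
  have hsub : Set.Ioi R ⊆ Set.Ioi 0 := Set.Ioi_subset_Ioi hR.le
  rw [Real.Gamma_eq_integral (zero_lt_one.trans_le hs), ← integral_exp_neg_Ioi R,
    ← MeasureTheory.integral_mul_const]
  calc ∫ x in Set.Ioi R, Real.exp (-x) * R ^ (s - 1)
      ≤ ∫ x in Set.Ioi R, Real.exp (-x) * x ^ (s - 1) := by
        refine MeasureTheory.setIntegral_mono_on ((integrableOn_exp_neg_Ioi R).mul_const _)
          (hint.mono_set hsub) measurableSet_Ioi fun x hx => ?_
        have hx' : R ≤ x := le_of_lt hx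
        have hs' : 0 ≤ s - 1 := sub_nonneg.2 hs
        gcongr
    _ ≤ ∫ x in Set.Ioi 0, Real.exp (-x) * x ^ (s - 1) := by
        refine MeasureTheory.setIntegral_mono_set hint ?_ hsub.eventuallyLE
        filter_upwards [MeasureTheory.ae_restrict_mem measurableSet_Ioi] with x hx
        have hx' : 0 < x := hx
        positivity

/-- The Mittag-Leffler series converges everywhere. -/
theorem summable_mittagLeffler {α β : ℝ} (hα : 0 < α) (hβ : 1 ≤ β) (z : ℝ) :
    Summable fun k : ℕ => z ^ k / Real.Gamma (α * k + β) := by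
  set q : ℝ := 2 * (|z| + 1) with hq
  have hq0 : 0 < q := by positivity
  set R : ℝ := q ^ α⁻¹ with hRdef
  have hR : 0 < R := Real.rpow_pos_of_pos hq0 _
  have hRα : R ^ α = q := Real.rpow_inv_rpow hq0.le hα.ne'
  refine Summable.of_norm_bounded (g := fun k : ℕ =>
    (Real.exp (-R) * R ^ (β - 1))⁻¹ * (1 / 2) ^ k) (summable_geometric_two.mul_left _) fun k => ?_
  have hs : 1 ≤ α * k + β := by nlinarith [mul_nonneg hα.le (Nat.cast_nonneg (α := ℝ) k)]
  have hG := Real.exp_neg_mul_rpow_le_Gamma hR hs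
  have hsplit : R ^ (α * k + β - 1) = q ^ k * R ^ (β - 1) := by
    rw [add_sub_assoc, Real.rpow_add hR, Real.rpow_mul hR.le, hRα, Real.rpow_natCast]
  rw [hsplit] at hG
  rw [norm_div, norm_pow, Real.norm_eq_abs, Real.norm_eq_abs,
    abs_of_pos (Real.Gamma_pos_of_pos (zero_lt_one.trans_le hs))]
  calc |z| ^ k / Real.Gamma (α * k + β)
      ≤ (q / 2) ^ k / (Real.exp (-R) * (q ^ k * R ^ (β - 1))) := by
        gcongr
        rw [hq]; linarith
    _ = (Real.exp (-R) * R ^ (β - 1))⁻¹ * (1 / 2) ^ k := by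
        rw [div_pow, div_pow, one_pow]
        field_simp

/-- The derivative of `E_α` is `E_{α,α} / α`. -/
theorem hasDerivAt_mittagLeffler_one {α : ℝ} (hα : 0 < α) (z : ℝ) :
    HasDerivAt (mittagLeffler α 1) (mittagLeffler α α z / α) z := by
  set r : ℝ := |z| + 1 with hr
  have hr1 : 1 ≤ r := by rw [hr]; linarith [abs_nonneg z]
  have hpos (k : ℕ) : 0 < Real.Gamma (α * k + 1) := Real.Gamma_pos_of_pos (by positivity)
  have hbound (k : ℕ) (y : ℝ) (hy : y ∈ Metric.ball (0 : ℝ) r) :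
      ‖k * y ^ (k - 1) / Real.Gamma (α * k + 1)‖ ≤ (2 * r) ^ k / Real.Gamma (α * k + 1) := by
    have hy' : |y| ≤ r := by simpa using (mem_ball_zero_iff.1 hy).le
    have hk : (k : ℝ) ≤ 2 ^ k := mod_cast k.lt_two_pow_self.le
    rw [norm_div, norm_mul, norm_pow, Real.norm_eq_abs, Real.norm_eq_abs, Real.norm_eq_abs,
      abs_of_pos (hpos k), Nat.abs_cast, mul_pow]
    have := (hpos k).le
    gcongr
    calc |y| ^ (k - 1) ≤ r ^ (k - 1) := by gcongr
      _ ≤ r ^ k := pow_le_pow_right₀ hr1 (Nat.sub_le k 1)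
  have hz : z ∈ Metric.ball (0 : ℝ) r := by simp [hr]
  have hu := summable_mittagLeffler hα le_rfl (2 * r)
  have hder := hasDerivAt_tsum_of_isPreconnected hu Metric.isOpen_ball
    (convex_ball (0 : ℝ) r).isPreconnected
    (fun k y _ => (hasDerivAt_pow k y).div_const (Real.Gamma (α * k + 1)))
    hbound hz (summable_mittagLeffler hα le_rfl z) hz
  refine hder.congr_deriv ?_
  rw [(Summable.of_norm_bounded hu fun k => hbound k z hz).tsum_eq_zero_add, mittagLeffler,
    ← tsum_div_const]
  simp only [Nat.cast_zero, zero_mul, zero_div, zero_add, Nat.add_sub_cancel]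
  refine tsum_congr fun k => ?_
  have hk : α * ((k + 1 : ℕ) : ℝ) ≠ 0 := by positivity
  have hG : Real.Gamma (α * k + α) ≠ 0 := (Real.Gamma_pos_of_pos (by positivity)).ne'
  rw [Real.Gamma_add_one hk, Nat.cast_add_one, mul_add_one]
  field_simp

/-- For `0 < α < 1`, `λ > 0` and `t > 0`, the map `t ↦ E_α(−λ t^α)` is differentiable at `t`
with derivative `−λ · t^{α−1} · E_{α,α}(−λ t^α)`. -/
theorem hasDerivAt_mittagLeffler (α lam : ℝ) (hα0 : 0 < α) (hα1 : α < 1) (hlam : 0 < lam)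
    (t : ℝ) (ht : 0 < t) :
    HasDerivAt (fun τ : ℝ => mittagLeffler α 1 (-(lam * τ ^ α)))
      (-lam * t ^ (α - 1) * mittagLeffler α α (-(lam * t ^ α))) t := by
  have hinner : HasDerivAt (fun τ : ℝ => -(lam * τ ^ α)) (-(lam * (α * t ^ (α - 1)))) t :=
    ((Real.hasDerivAt_rpow_const (Or.inl ht.ne')).const_mul lam).neg
  refine ((hasDerivAt_mittagLeffler_one hα0 _).comp t hinner).congr_deriv ?_
  field_simp
end

section
/- Let 0 < α < 1 and λ > 0. Then the Mittag-Leffler waiting-time density integrates to one: ∫₀^∞ λ · τ^{α−1} · E_{α,α}(−λ τ^α) dτ = 1; equivalently, E_α(−λ t^α) → 0 as t → ∞ and E_α(0) = 1. -/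
open MeasureTheory

open Set Filter Topology

theorem rpow_mul_exp_neg_le_Gamma {x M : ℝ} (hx : 1 ≤ x) (hM : 0 < M) :
    M ^ (x - 1) * Real.exp (-M) ≤ Real.Gamma x := by
  rw [Real.Gamma_eq_integral (by linarith)]
  have hsub : Ioi M ⊆ Ioi (0 : ℝ) := Ioi_subset_Ioi hM.le
  have hint := Real.GammaIntegral_convergent (s := x) (by linarith)
  calc M ^ (x - 1) * Real.exp (-M)
      = ∫ t in Ioi M, M ^ (x - 1) * Real.exp (-t) := by
        rw [integral_const_mul, integral_exp_neg_Ioi]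
    _ ≤ ∫ t in Ioi M, Real.exp (-t) * t ^ (x - 1) := by
        refine setIntegral_mono_on ((integrableOn_exp_neg_Ioi M).const_mul _) (hint.mono_set hsub)
          measurableSet_Ioi fun t ht => ?_
        rw [mul_comm]
        have : M ^ (x - 1) ≤ t ^ (x - 1) :=
          Real.rpow_le_rpow hM.le (le_of_lt ht) (by linarith)
        gcongr
    _ ≤ ∫ t in Ioi 0, Real.exp (-t) * t ^ (x - 1) := by
        refine setIntegral_mono_set hint ?_ hsub.eventuallyLE
        filter_upwards [ae_restrict_mem measurableSet_Ioi] with t ht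
        have : (0 : ℝ) < t := ht
        simp only [Pi.zero_apply]
        positivity

theorem Gamma_linear_pos {α β : ℝ} (hα : 0 < α) (hβ : 0 < β) (k : ℕ) :
    0 < Real.Gamma (α * k + β) :=
  Real.Gamma_pos_of_pos (by positivity)

theorem summable_pow_div_Gamma {α β : ℝ} (hα : 0 < α) (hβ : 0 < β) (z : ℝ) :
    Summable fun k : ℕ => z ^ k / Real.Gamma (α * k + β) := by
  obtain ⟨M, hM, hMz⟩ : ∃ M : ℝ, 0 < M ∧ 2 * |z| ≤ M ^ α := by
    have h := (tendsto_rpow_atTop hα).eventually_ge_atTop (2 * |z|)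
    obtain ⟨M, h1, h2⟩ := (h.and (eventually_gt_atTop 0)).exists
    exact ⟨M, h2, h1⟩
  refine Summable.of_norm_bounded_eventually_nat
    (g := fun k => (1 / 2 : ℝ) ^ k * (Real.exp M * M ^ (1 - β)))
    ((summable_geometric_two).mul_right _) ?_
  obtain ⟨N, hN⟩ := exists_nat_gt (1 / α)
  filter_upwards [eventually_ge_atTop N] with k hk
  have hk' : 1 ≤ α * k + β := by
    have : 1 / α < k := hN.trans_le (by exact_mod_cast hk)
    rw [div_lt_iff₀ hα] at this
    nlinarith
  have hG := rpow_mul_exp_neg_le_Gamma hk' hM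
  have hΓ := Gamma_linear_pos hα hβ k
  rw [norm_div, norm_pow, Real.norm_eq_abs, Real.norm_eq_abs, abs_of_pos hΓ, div_le_iff₀ hΓ]
  have hpow : M ^ (α * k + β - 1) = (M ^ α) ^ k * M ^ (β - 1) := by
    rw [← Real.rpow_mul_natCast hM.le, ← Real.rpow_add hM]
    ring_nf
  calc |z| ^ k = (1 / 2) ^ k * (2 * |z|) ^ k := by rw [← mul_pow]; ring_nf
    _ ≤ (1 / 2) ^ k * (M ^ α) ^ k := by gcongr
    _ = (1 / 2) ^ k * (Real.exp M * M ^ (1 - β)) * (M ^ (α * k + β - 1) * Real.exp (-M)) := by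
        rw [hpow, Real.exp_neg, show 1 - β = -(β - 1) by ring, Real.rpow_neg hM.le]
        have := (Real.exp_pos M).ne'
        have := (Real.rpow_pos_of_pos hM (β - 1)).ne'
        field_simp
    _ ≤ _ := by gcongr

theorem contDiff_mittagLeffler {α β : ℝ} (hα : 0 < α) (hβ : 0 < β) :
    ContDiff ℝ 1 (mittagLeffler α β) := by
  let c : ℕ → ℝ := fun k => (Real.Gamma (α * k + β))⁻¹
  have hrad : (FormalMultilinearSeries.ofScalars ℝ c).radius = ⊤ := by
    refine FormalMultilinearSeries.radius_eq_top_of_summable_norm _ fun r => ?_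
    refine (summable_pow_div_Gamma hα hβ (r : ℝ)).congr fun k => ?_
    rw [FormalMultilinearSeries.ofScalars_norm, Real.norm_eq_abs,
      abs_of_pos (inv_pos.2 (Gamma_linear_pos hα hβ k)), div_eq_mul_inv, mul_comm]
  have hp := (FormalMultilinearSeries.ofScalars ℝ c).hasFPowerSeriesOnBall (by simp [hrad])
  rw [hrad] at hp
  have hsum : (FormalMultilinearSeries.ofScalars ℝ c).sum = mittagLeffler α β := by
    ext z
    change FormalMultilinearSeries.ofScalarsSum c z = _
    rw [FormalMultilinearSeries.ofScalars_sum_eq]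
    refine tsum_congr fun k => ?_
    simp [c, div_eq_mul_inv, mul_comm]
  rw [hsum] at hp
  have : AnalyticOnNhd ℝ (mittagLeffler α β) univ := by
    simpa using hp.analyticOnNhd
  exact this.contDiff

theorem mittagLeffler_zero (α β : ℝ) : mittagLeffler α β 0 = (Real.Gamma β)⁻¹ := by
  rw [mittagLeffler, tsum_eq_single 0]
  · simp
  · intro k hk
    simp [hk]

theorem mittagLeffler_eq_add_mul {α β : ℝ} (hα : 0 < α) (hβ : 0 < β) (z : ℝ) :
    mittagLeffler α β z = (Real.Gamma β)⁻¹ + z * mittagLeffler α (α + β) z := by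
  rw [mittagLeffler, (summable_pow_div_Gamma hα hβ z).tsum_eq_zero_add, mittagLeffler,
    ← tsum_mul_left]
  congr 1
  · simp
  · refine tsum_congr fun k => ?_
    rw [pow_succ', mul_div_assoc]
    push_cast
    ring_nf

theorem integral_sub_rpow_mul_rpow {a b t : ℝ} (ha : 0 < a) (hb : 0 < b) (ht : 0 < t) :
    ∫ s in (0 : ℝ)..t, (t - s) ^ (a - 1) * s ^ (b - 1) =
      Real.Gamma a * Real.Gamma b / Real.Gamma (a + b) * t ^ (a + b - 1) := by
  have h := Complex.betaIntegral_scaled (b : ℂ) (a : ℂ) ht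
  rw [Complex.betaIntegral_eq_Gamma_mul_div _ _ (by simpa) (by simpa)] at h
  have hcongr : ∫ x in (0 : ℝ)..t, (x : ℂ) ^ ((b : ℂ) - 1) * ((t : ℂ) - x) ^ ((a : ℂ) - 1) =
      ∫ x in (0 : ℝ)..t, (((t - x) ^ (a - 1) * x ^ (b - 1) : ℝ) : ℂ) := by
    refine intervalIntegral.integral_congr fun x hx => ?_
    rw [uIcc_of_le ht.le] at hx
    rw [Complex.ofReal_mul, Complex.ofReal_cpow hx.1, Complex.ofReal_cpow (by linarith [hx.2])]
    push_cast
    ring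
  rw [hcongr, intervalIntegral.integral_ofReal, ← Complex.ofReal_add, Complex.Gamma_ofReal,
    Complex.Gamma_ofReal, Complex.Gamma_ofReal] at h
  have h1 : ((t : ℂ) ^ (((b + a : ℝ) : ℂ) - 1)) = ((t ^ (b + a - 1) : ℝ) : ℂ) := by
    rw [Complex.ofReal_cpow ht.le]; push_cast; rfl
  rw [h1] at h
  norm_cast at h
  rw [h, add_comm b a]
  ring

theorem intervalIntegrable_sub_rpow_mul_rpow {a b t : ℝ} (ha : 0 < a) (hb : 0 < b) (ht : 0 < t) :
    IntervalIntegrable (fun s => (t - s) ^ (a - 1) * s ^ (b - 1)) volume 0 t := by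
  refine intervalIntegral.intervalIntegrable_of_integral_ne_zero ?_
  rw [integral_sub_rpow_mul_rpow ha hb ht]
  have := Real.Gamma_pos_of_pos ha
  have := Real.Gamma_pos_of_pos hb
  have := Real.Gamma_pos_of_pos (add_pos ha hb)
  positivity

theorem continuous_mittagLeffler_rpow {α β : ℝ} (hα : 0 < α) (hβ : 0 < β) (lam : ℝ) :
    Continuous fun s : ℝ => mittagLeffler α β (-(lam * s ^ α)) :=
  (contDiff_mittagLeffler hα hβ).continuous.comp
    ((Real.continuous_rpow_const hα.le).const_mul lam).neg

theorem intervalIntegrable_sub_rpow_mul_mittagLeffler {α a b t : ℝ} (hα : 0 < α) (ha : 0 < a)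
    (hb : 0 < b) (ht : 0 < t) (lam : ℝ) :
    IntervalIntegrable
      (fun s => (t - s) ^ (a - 1) * (s ^ (b - 1) * mittagLeffler α b (-(lam * s ^ α))))
      volume 0 t := by
  simp only [← mul_assoc]
  exact (intervalIntegrable_sub_rpow_mul_rpow ha hb ht).mul_continuousOn
    (continuous_mittagLeffler_rpow hα hb lam).continuousOn

/-- The fractional integral of order `a` of `s^{b-1} E_{α,b}(-λ s^α)` is
`t^{a+b-1} E_{α,a+b}(-λ t^α)`. -/
theorem integral_sub_rpow_mul_mittagLeffler {α a b t : ℝ} (hα : 0 < α) (ha : 0 < a)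
    (hb : 0 < b) (ht : 0 < t) (lam : ℝ) :
    ∫ s in (0 : ℝ)..t, (t - s) ^ (a - 1) * (s ^ (b - 1) * mittagLeffler α b (-(lam * s ^ α))) =
      Real.Gamma a * (t ^ (a + b - 1) * mittagLeffler α (a + b) (-(lam * t ^ α))) := by
  let F : ℕ → ℝ → ℝ := fun k s =>
    (-lam) ^ k / Real.Gamma (α * k + b) * ((t - s) ^ (a - 1) * s ^ (α * k + b - 1))
  have hb' : ∀ k : ℕ, 0 < α * k + b := fun k => by positivity
  have hFint : ∀ k, IntegrableOn (F k) (Ioc 0 t) := fun k =>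
    ((intervalIntegrable_iff_integrableOn_Ioc_of_le ht.le).1
      (intervalIntegrable_sub_rpow_mul_rpow ha (hb' k) ht)).const_mul _
  have hval : ∀ (c : ℝ) (k : ℕ), ∫ s in Ioc 0 t,
      c ^ k / Real.Gamma (α * k + b) * ((t - s) ^ (a - 1) * s ^ (α * k + b - 1)) =
      Real.Gamma a * t ^ (a + b - 1) * ((c * t ^ α) ^ k / Real.Gamma (α * k + (a + b))) := by
    intro c k
    rw [integral_const_mul, ← intervalIntegral.integral_of_le ht.le,
      integral_sub_rpow_mul_rpow ha (hb' k) ht, mul_pow, ← Real.rpow_mul_natCast ht.le,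
      show a + (α * k + b) = α * k + (a + b) by ring,
      show α * k + (a + b) - 1 = (a + b - 1) + α * k by ring, Real.rpow_add ht]
    have := (Gamma_linear_pos hα hb k).ne'
    field_simp
  have hnorm : ∀ k, ∫ s in Ioc 0 t, ‖F k s‖ =
      Real.Gamma a * t ^ (a + b - 1) * ((|lam| * t ^ α) ^ k / Real.Gamma (α * k + (a + b))) := by
    intro k
    rw [← hval]
    refine setIntegral_congr_fun measurableSet_Ioc fun s hs => ?_
    have h1 : 0 ≤ (t - s) ^ (a - 1) := Real.rpow_nonneg (by linarith [hs.2]) _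
    have h2 : 0 ≤ s ^ (α * k + b - 1) := Real.rpow_nonneg hs.1.le _
    simp only [F, norm_mul, norm_div, norm_pow, norm_neg, Real.norm_eq_abs,
      abs_of_pos (Gamma_linear_pos hα hb k), abs_of_nonneg h1, abs_of_nonneg h2]
  have hsum := hasSum_integral_of_summable_integral_norm hFint (by
    simp only [hnorm]
    exact (summable_pow_div_Gamma hα (add_pos ha hb) _).mul_left _)
  have hfun : ∫ s in Ioc 0 t, ∑' k, F k s = ∫ s in Ioc 0 t,
      (t - s) ^ (a - 1) * (s ^ (b - 1) * mittagLeffler α b (-(lam * s ^ α))) := by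
    refine setIntegral_congr_fun measurableSet_Ioc fun s hs => ?_
    simp only [mittagLeffler]
    rw [← tsum_mul_left, ← tsum_mul_left]
    refine tsum_congr fun k => ?_
    simp only [F]
    rw [← neg_mul, mul_pow, ← Real.rpow_mul_natCast hs.1.le,
      show α * k + b - 1 = b - 1 + α * k by ring, Real.rpow_add hs.1]
    ring
  rw [intervalIntegral.integral_of_le ht.le, ← hfun, ← hsum.tsum_eq]
  simp only [F, hval]
  rw [tsum_mul_left, mittagLeffler, neg_mul, mul_assoc]

theorem intervalIntegrable_rpow_mul_mittagLeffler {α β : ℝ} (hα : 0 < α) (hβ : 0 < β)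
    (lam x y : ℝ) :
    IntervalIntegrable (fun s : ℝ => s ^ (β - 1) * mittagLeffler α β (-(lam * s ^ α)))
      volume x y :=
  (intervalIntegral.intervalIntegrable_rpow' (by linarith)).mul_continuousOn
    (continuous_mittagLeffler_rpow hα hβ lam).continuousOn

theorem mul_integral_rpow_mul_mittagLeffler {α t : ℝ} (hα : 0 < α) (ht : 0 < t) (lam : ℝ) :
    lam * ∫ s in (0 : ℝ)..t, s ^ (α - 1) * mittagLeffler α α (-(lam * s ^ α)) =
      1 - mittagLeffler α 1 (-(lam * t ^ α)) := by
  have h := integral_sub_rpow_mul_mittagLeffler hα one_pos hα ht lam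
  simp only [sub_self, Real.rpow_zero, one_mul, Real.Gamma_one, add_sub_cancel_left] at h
  rw [h, mittagLeffler_eq_add_mul hα one_pos, Real.Gamma_one, add_comm α 1]
  ring

theorem integral_sub_rpow_neg_mul_mittagLeffler {α t : ℝ} (hα0 : 0 < α) (hα1 : α < 1)
    (ht : 0 < t) (lam : ℝ) :
    ∫ s in (0 : ℝ)..t, (t - s) ^ (-α) * (s ^ (α - 1) * mittagLeffler α α (-(lam * s ^ α))) =
      Real.Gamma (1 - α) * mittagLeffler α 1 (-(lam * t ^ α)) := by
  have h := integral_sub_rpow_mul_mittagLeffler hα0 (sub_pos.2 hα1) hα0 ht lam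
  simpa using h

theorem rpow_neg_add_le_rpow_neg {a x y z : ℝ} (ha : 0 ≤ a) (hx : 0 < x) (hxy : x ≤ y)
    (hyz : y ≤ z) : y ^ (-a) + a * z ^ (-a - 1) * (y - x) ≤ x ^ (-a) := by
  have hy : 0 < y := hx.trans_le hxy
  have h1 : z ^ (-a - 1) ≤ y ^ (-a - 1) :=
    Real.rpow_le_rpow_of_nonpos hy hyz (by linarith)
  have h2 : 1 + a * (1 - x / y) ≤ (x / y) ^ (-a) := by
    have hlog : 1 - x / y ≤ -Real.log (x / y) := by
      have := Real.log_le_sub_one_of_pos (div_pos hx hy)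
      linarith
    rw [Real.rpow_def_of_pos (div_pos hx hy)]
    have := Real.add_one_le_exp (Real.log (x / y) * -a)
    nlinarith
  have h3 : x ^ (-a) = y ^ (-a) * (x / y) ^ (-a) := by
    rw [← Real.mul_rpow hy.le (div_pos hx hy).le, mul_div_cancel₀ _ hy.ne']
  have h4 : y ^ (-a - 1) = y ^ (-a) / y := Real.rpow_sub_one hy.ne' _
  calc y ^ (-a) + a * z ^ (-a - 1) * (y - x)
      ≤ y ^ (-a) + a * y ^ (-a - 1) * (y - x) := by
        have : 0 ≤ y - x := by linarith
        gcongr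
    _ = y ^ (-a) * (1 + a * (1 - x / y)) := by rw [h4]; field_simp
    _ ≤ x ^ (-a) := by
        rw [h3]
        have := Real.rpow_nonneg hy.le (-a)
        gcongr

/-- If `E_{α,α}(-λ s^α)` is positive before `t` and nonpositive at `t`, then the fractional
integral `∫₀ᵗ (t - s)^{-α} s^{α-1} E_{α,α}(-λ s^α) ds`, a multiple of `E_α(-λ t^α)`, drops
linearly as the argument approaches `t` from the left, while `E_α(-λ s^α)` varies only
quadratically there. -/
theorem mittagLeffler_self_pos_of_forall_lt {α lam t : ℝ} (hα0 : 0 < α) (hα1 : α < 1)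
    (hlam : 0 < lam) (ht : 0 < t)
    (hpos : ∀ s, 0 < s → s < t → 0 < mittagLeffler α α (-(lam * s ^ α))) :
    0 < mittagLeffler α α (-(lam * t ^ α)) := by
  by_contra! hnonpos
  set r : ℝ → ℝ := fun s => s ^ (α - 1) * mittagLeffler α α (-(lam * s ^ α)) with hr
  have hrpos : ∀ s, 0 < s → s < t → 0 < r s := fun s h0 h1 =>
    mul_pos (Real.rpow_pos_of_pos h0 _) (hpos s h0 h1)
  have hrt : r t ≤ 0 := mul_nonpos_of_nonneg_of_nonpos (Real.rpow_nonneg ht.le _) hnonpos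
  have hrint : ∀ x y, IntervalIntegrable r volume x y :=
    intervalIntegrable_rpow_mul_mittagLeffler hα0 hα0 lam
  obtain ⟨K, δ, hδ, hδt, hK⟩ : ∃ K δ : ℝ, 0 < δ ∧ δ ≤ t / 2 ∧
      ∀ s, t - δ < s → s ≤ t → r s ≤ K * (t - s) := by
    have hsmooth : ContDiffAt ℝ 1 r t := by
      have h1 : ∀ p : ℝ, ContDiffAt ℝ 1 (fun s : ℝ => s ^ p) t := fun p =>
        Real.contDiffAt_rpow_const_of_ne ht.ne'
      exact (h1 _).mul ((contDiff_mittagLeffler hα0 hα0).contDiffAt.comp t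
        (contDiffAt_const.mul (h1 _)).neg)
    obtain ⟨K, V, hV, hLip⟩ := hsmooth.exists_lipschitzOnWith
    obtain ⟨ε, hε, hball⟩ := Metric.mem_nhds_iff.1 hV
    refine ⟨K, min ε (t / 2), lt_min hε (by linarith), min_le_right _ _, fun s hs hst => ?_⟩
    have hsV : s ∈ V := hball (by
      rw [Metric.mem_ball, Real.dist_eq, abs_sub_comm, abs_of_nonneg (by linarith)]
      linarith [min_le_left ε (t / 2)])
    have h := hLip.dist_le_mul s hsV t (mem_of_mem_nhds hV)
    rw [Real.dist_eq, Real.dist_eq, abs_sub_comm s t, abs_of_nonneg (sub_nonneg.2 hst)] at h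
    linarith [le_abs_self (r s - r t)]
  have hm : 0 < ∫ s in (0 : ℝ)..t / 2, r s :=
    intervalIntegral.intervalIntegral_pos_of_pos_on (hrint _ _)
      (fun s hs => hrpos s hs.1 (by linarith [hs.2])) (by linarith)
  set m := ∫ s in (0 : ℝ)..t / 2, r s
  set κ := α * t ^ (-α - 1)
  have hκ : 0 < κ := mul_pos hα0 (Real.rpow_pos_of_pos ht _)
  have hΓ : 0 < Real.Gamma (1 - α) := Real.Gamma_pos_of_pos (sub_pos.2 hα1)
  have hK0 : 0 < K := by
    have h1 := hK (t - δ / 2) (by linarith) (by linarith)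
    have h2 := hrpos (t - δ / 2) (by linarith) (by linarith)
    by_contra! hneg
    nlinarith
  have hker : ∀ T, 0 < T → IntervalIntegrable (fun s => (T - s) ^ (-α) * r s) volume 0 T := by
    intro T hT
    simpa using intervalIntegrable_sub_rpow_mul_mittagLeffler hα0 (sub_pos.2 hα1) hα0 hT lam
  have hbound : ∀ h, 0 < h → h < δ →
      κ * m ≤ Real.Gamma (1 - α) * (lam * (K * h)) + K * h ^ (1 - α) := by
    intro h h0 hhδ
    have hT : 0 < t - h := by linarith
    have hsub0 : uIcc 0 (t - h) ⊆ uIcc 0 t := by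
      rw [uIcc_of_le hT.le, uIcc_of_le ht.le]
      exact Icc_subset_Icc_right (by linarith)
    have hsub1 : uIcc (t - h) t ⊆ uIcc 0 t := by
      rw [uIcc_of_le (by linarith), uIcc_of_le ht.le]
      exact Icc_subset_Icc_left hT.le
    have hint0 := (hker t ht).mono_set hsub0
    have hint1 := (hker t ht).mono_set hsub1
    have hfar : (∫ s in (0 : ℝ)..(t - h), (t - s) ^ (-α) * r s) + κ * h * m ≤
        ∫ s in (0 : ℝ)..(t - h), (t - h - s) ^ (-α) * r s := by
      have hmono : m ≤ ∫ s in (0 : ℝ)..(t - h), r s := by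
        rw [← intervalIntegral.integral_add_adjacent_intervals (hrint 0 (t / 2))
          (hrint (t / 2) (t - h))]
        refine le_add_of_nonneg_right
          (intervalIntegral.integral_nonneg (by linarith) fun s hs => ?_)
        exact (hrpos s (by linarith [hs.1]) (by linarith [hs.2])).le
      calc (∫ s in (0 : ℝ)..(t - h), (t - s) ^ (-α) * r s) + κ * h * m
          ≤ (∫ s in (0 : ℝ)..(t - h), (t - s) ^ (-α) * r s) +
              κ * h * ∫ s in (0 : ℝ)..(t - h), r s := by gcongr
        _ = ∫ s in (0 : ℝ)..(t - h), ((t - s) ^ (-α) * r s + κ * h * r s) := by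
            rw [intervalIntegral.integral_add hint0 ((hrint _ _).const_mul _),
              intervalIntegral.integral_const_mul]
        _ ≤ _ := by
            refine intervalIntegral.integral_mono_on_of_le_Ioo hT.le
              (hint0.add ((hrint _ _).const_mul _)) (hker _ hT) fun s hs => ?_
            have h1 := rpow_neg_add_le_rpow_neg hα0.le (sub_pos.2 hs.2)
              (show t - h - s ≤ t - s by linarith) (show t - s ≤ t by linarith [hs.1])
            rw [show t - s - (t - h - s) = h by ring] at h1
            have h2 := (hrpos s hs.1 (by linarith [hs.2])).le
            rw [← add_mul]
            gcongr
    have hnear : ∫ s in (t - h)..t, (t - s) ^ (-α) * r s ≤ K * h ^ (1 - α) * h := by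
      calc ∫ s in (t - h)..t, (t - s) ^ (-α) * r s
          ≤ ∫ _ in (t - h)..t, K * h ^ (1 - α) := by
            refine intervalIntegral.integral_mono_on_of_le_Ioo (by linarith) hint1
              intervalIntegrable_const fun s hs => ?_
            have hts : 0 < t - s := sub_pos.2 hs.2
            calc (t - s) ^ (-α) * r s ≤ (t - s) ^ (-α) * (K * (t - s)) := by
                  have := hK s (by linarith [hs.1]) hs.2.le
                  gcongr
              _ = K * (t - s) ^ (1 - α) := by
                  rw [show 1 - α = -α + 1 by ring, Real.rpow_add_one hts.ne']
                  ring
              _ ≤ K * h ^ (1 - α) := by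
                  have : t - s ≤ h := by linarith [hs.1]
                  gcongr
        _ = K * h ^ (1 - α) * h := by
            rw [intervalIntegral.integral_const, smul_eq_mul]
            ring
    have hquad : ∫ s in (t - h)..t, r s ≤ K * h * h := by
      calc ∫ s in (t - h)..t, r s ≤ ∫ _ in (t - h)..t, K * h := by
            refine intervalIntegral.integral_mono_on_of_le_Ioo (by linarith) (hrint _ _)
              intervalIntegrable_const fun s hs => ?_
            refine (hK s (by linarith [hs.1]) hs.2.le).trans ?_
            have : t - s ≤ h := by linarith [hs.1]
            gcongr
        _ = K * h * h := by
            rw [intervalIntegral.integral_const, smul_eq_mul]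
            ring
    have e1 := mul_integral_rpow_mul_mittagLeffler hα0 ht lam
    have e2 := mul_integral_rpow_mul_mittagLeffler hα0 hT lam
    have e3 := integral_sub_rpow_neg_mul_mittagLeffler hα0 hα1 ht lam
    have e4 := integral_sub_rpow_neg_mul_mittagLeffler hα0 hα1 hT lam
    change lam * ∫ s in (0 : ℝ)..t, r s = _ at e1
    change lam * ∫ s in (0 : ℝ)..(t - h), r s = _ at e2
    change ∫ s in (0 : ℝ)..t, (t - s) ^ (-α) * r s = _ at e3
    change ∫ s in (0 : ℝ)..(t - h), (t - h - s) ^ (-α) * r s = _ at e4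
    rw [← intervalIntegral.integral_add_adjacent_intervals (hrint 0 (t - h))
      (hrint (t - h) t)] at e1
    rw [← intervalIntegral.integral_add_adjacent_intervals hint0 hint1] at e3
    have hdiff : mittagLeffler α 1 (-(lam * (t - h) ^ α)) - mittagLeffler α 1 (-(lam * t ^ α)) ≤
        lam * (K * h * h) := by
      have := mul_le_mul_of_nonneg_left hquad hlam.le
      linarith
    have hdiff' := mul_le_mul_of_nonneg_left hdiff hΓ.le
    refine le_of_mul_le_mul_right ?_ h0
    linarith
  have hlim : Tendsto (fun h : ℝ => Real.Gamma (1 - α) * (lam * (K * h)) + K * h ^ (1 - α))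
      (𝓝[>] 0) (𝓝 0) := by
    have hcont : Continuous fun h : ℝ =>
        Real.Gamma (1 - α) * (lam * (K * h)) + K * h ^ (1 - α) := by
      have := Real.continuous_rpow_const (sub_pos.2 hα1).le
      fun_prop
    have h := (hcont.tendsto 0).mono_left (nhdsWithin_le_nhds (s := Ioi 0))
    simpa [Real.zero_rpow (sub_pos.2 hα1).ne'] using h
  have : κ * m ≤ 0 := ge_of_tendsto hlim <| by
    filter_upwards [Ioo_mem_nhdsGT hδ] with h hh using hbound h hh.1 hh.2
  exact absurd (mul_pos hκ hm) (not_lt.2 this)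

theorem mittagLeffler_self_pos {α lam : ℝ} (hα0 : 0 < α) (hα1 : α < 1) (hlam : 0 < lam) {t : ℝ}
    (ht : 0 ≤ t) : 0 < mittagLeffler α α (-(lam * t ^ α)) := by
  by_contra! hneg
  have hcont := continuous_mittagLeffler_rpow hα0 hα0 lam
  let S : Set ℝ := {s | 0 ≤ s ∧ mittagLeffler α α (-(lam * s ^ α)) ≤ 0}
  have hclosed : IsClosed S :=
    isClosed_Ici.inter (isClosed_le hcont continuous_const)
  have hbdd : BddBelow S := ⟨0, fun s hs => hs.1⟩
  have hmem : sInf S ∈ S := hclosed.csInf_mem ⟨t, ht, hneg⟩ hbdd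
  have hpos : 0 < sInf S := by
    refine hmem.1.lt_of_ne fun h0 => ?_
    have h := hmem.2
    rw [← h0, Real.zero_rpow hα0.ne', mul_zero, neg_zero, mittagLeffler_zero] at h
    exact absurd (inv_pos.2 (Real.Gamma_pos_of_pos hα0)) (not_lt.2 h)
  refine absurd (mittagLeffler_self_pos_of_forall_lt hα0 hα1 hlam hpos fun s h0 hs => ?_)
    (not_lt.2 hmem.2)
  by_contra! hle
  exact absurd (csInf_le hbdd ⟨h0.le, hle⟩) (not_le.2 hs)

theorem mittagLeffler_one_nonneg {α lam t : ℝ} (hα0 : 0 < α) (hα1 : α < 1) (hlam : 0 < lam)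
    (ht : 0 < t) : 0 ≤ mittagLeffler α 1 (-(lam * t ^ α)) := by
  refine nonneg_of_mul_nonneg_right ?_ (Real.Gamma_pos_of_pos (sub_pos.2 hα1))
  rw [← integral_sub_rpow_neg_mul_mittagLeffler hα0 hα1 ht lam]
  refine intervalIntegral.integral_nonneg ht.le fun s hs => ?_
  exact mul_nonneg (Real.rpow_nonneg (sub_nonneg.2 hs.2) _)
    (mul_nonneg (Real.rpow_nonneg hs.1 _) (mittagLeffler_self_pos hα0 hα1 hlam hs.1).le)

theorem mittagLeffler_one_anti {α lam s t : ℝ} (hα0 : 0 < α) (hα1 : α < 1) (hlam : 0 < lam)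
    (hs : 0 < s) (hst : s ≤ t) :
    mittagLeffler α 1 (-(lam * t ^ α)) ≤ mittagLeffler α 1 (-(lam * s ^ α)) := by
  have hint := intervalIntegrable_rpow_mul_mittagLeffler hα0 hα0 lam
  have e1 := mul_integral_rpow_mul_mittagLeffler hα0 hs lam
  have e2 := mul_integral_rpow_mul_mittagLeffler hα0 (hs.trans_le hst) lam
  rw [← intervalIntegral.integral_add_adjacent_intervals (hint 0 s) (hint s t)] at e2
  have h : 0 ≤ ∫ x in s..t, x ^ (α - 1) * mittagLeffler α α (-(lam * x ^ α)) :=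
    intervalIntegral.integral_nonneg hst fun x hx =>
      mul_nonneg (Real.rpow_nonneg (hs.le.trans hx.1) _)
        (mittagLeffler_self_pos hα0 hα1 hlam (hs.le.trans hx.1)).le
  have := mul_nonneg hlam.le h
  linarith

theorem mittagLeffler_one_le {α lam t : ℝ} (hα0 : 0 < α) (hα1 : α < 1) (hlam : 0 < lam)
    (ht : 0 < t) :
    mittagLeffler α 1 (-(lam * t ^ α)) ≤ Real.Gamma (α + 1) / lam * t ^ (-α) := by
  set u : ℝ → ℝ := fun s => mittagLeffler α 1 (-(lam * s ^ α))
  have hΓ := Real.Gamma_pos_of_pos hα0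
  have hΓ' := Real.Gamma_pos_of_pos (add_pos hα0 one_pos)
  have htα := Real.rpow_pos_of_pos ht α
  have hvolterra := integral_sub_rpow_mul_mittagLeffler hα0 hα0 one_pos ht lam
  have hkernel := integral_sub_rpow_mul_rpow hα0 one_pos ht
  have hkint := intervalIntegrable_sub_rpow_mul_rpow hα0 one_pos ht
  have huint := intervalIntegrable_sub_rpow_mul_mittagLeffler hα0 hα0 one_pos ht lam
  simp only [sub_self, Real.rpow_zero, one_mul, mul_one, Real.Gamma_one, add_sub_cancel_right]
    at hvolterra hkernel hkint huint
  have hle : ∫ s in (0 : ℝ)..t, (t - s) ^ (α - 1) * u t ≤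
      ∫ s in (0 : ℝ)..t, (t - s) ^ (α - 1) * u s := by
    refine intervalIntegral.integral_mono_on_of_le_Ioo ht.le (hkint.mul_const _) huint
      fun s hs => ?_
    have := mittagLeffler_one_anti hα0 hα1 hlam hs.1 hs.2.le
    have := Real.rpow_nonneg (sub_nonneg.2 hs.2.le) (α - 1)
    gcongr
  rw [intervalIntegral.integral_mul_const, hkernel, hvolterra] at hle
  have hu : u t = 1 - lam * (t ^ α * mittagLeffler α (α + 1) (-(lam * t ^ α))) := by
    simp only [u]
    rw [mittagLeffler_eq_add_mul hα0 one_pos, Real.Gamma_one]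
    ring
  have hu0 : 0 ≤ u t := mittagLeffler_one_nonneg hα0 hα1 hlam ht
  rw [Real.rpow_neg ht.le, div_mul_eq_mul_div, le_div_iff₀ hlam, ← div_eq_mul_inv,
    le_div_iff₀ htα]
  rw [div_mul_eq_mul_div, div_mul_eq_mul_div, div_le_iff₀ hΓ', mul_assoc, mul_assoc] at hle
  have hle' := le_of_mul_le_mul_left hle hΓ
  have h := mul_le_mul_of_nonneg_left hle' hlam.le
  nlinarith

theorem tendsto_mittagLeffler_one {α lam : ℝ} (hα0 : 0 < α) (hα1 : α < 1) (hlam : 0 < lam) :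
    Tendsto (fun t : ℝ => mittagLeffler α 1 (-(lam * t ^ α))) atTop (𝓝 0) := by
  have h := (tendsto_rpow_neg_atTop hα0).const_mul (Real.Gamma (α + 1) / lam)
  rw [mul_zero] at h
  refine tendsto_of_tendsto_of_tendsto_of_le_of_le' tendsto_const_nhds h ?_ ?_
  · filter_upwards [eventually_gt_atTop 0] with t ht
      using mittagLeffler_one_nonneg hα0 hα1 hlam ht
  · filter_upwards [eventually_gt_atTop 0] with t ht using mittagLeffler_one_le hα0 hα1 hlam ht

/-- For `0 < α < 1` and `λ > 0`, the Mittag-Leffler waiting-time density integrates to one: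
`∫₀^∞ λ τ^{α−1} E_{α,α}(−λ τ^α) dτ = 1`; equivalently, `E_α(−λ t^α) → 0` as `t → ∞` and
`E_α(0) = 1`. -/
theorem mittagLeffler_density_integrates_to_one (α lam : ℝ) (hα0 : 0 < α) (hα1 : α < 1)
    (hlam : 0 < lam) :
    (∫ τ in Set.Ioi (0 : ℝ), lam * τ ^ (α - 1) * mittagLeffler α α (-(lam * τ ^ α))) = 1 ∧
    Filter.Tendsto (fun t : ℝ => mittagLeffler α 1 (-(lam * t ^ α)))
      Filter.atTop (nhds 0) ∧
    mittagLeffler α 1 0 = 1 := by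
  have hlim := tendsto_mittagLeffler_one hα0 hα1 hlam
  refine ⟨?_, hlim, by simp [mittagLeffler_zero]⟩
  set f : ℝ → ℝ := fun τ => lam * τ ^ (α - 1) * mittagLeffler α α (-(lam * τ ^ α))
  have hf : f = fun τ => lam * (τ ^ (α - 1) * mittagLeffler α α (-(lam * τ ^ α))) := by
    ext τ
    exact mul_assoc _ _ _
  have hint : ∀ x y, IntervalIntegrable f volume x y := by
    rw [hf]
    exact fun x y => (intervalIntegrable_rpow_mul_mittagLeffler hα0 hα0 lam x y).const_mul lam
  have hval : Tendsto (fun t => ∫ τ in (0 : ℝ)..t, f τ) atTop (𝓝 1) := by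
    have h := hlim.const_sub 1
    rw [sub_zero] at h
    refine h.congr' ?_
    filter_upwards [eventually_gt_atTop 0] with t ht
    rw [hf, intervalIntegral.integral_const_mul, mul_integral_rpow_mul_mittagLeffler hα0 ht]
  have hnorm : Tendsto (fun t => ∫ τ in (0 : ℝ)..t, ‖f τ‖) atTop (𝓝 1) := by
    refine hval.congr' ?_
    filter_upwards [eventually_gt_atTop 0] with t ht
    refine intervalIntegral.integral_congr fun τ hτ => ?_
    rw [uIcc_of_le ht.le] at hτ
    exact (Real.norm_of_nonneg (mul_nonneg (mul_nonneg hlam.le (Real.rpow_nonneg hτ.1 _))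
      (mittagLeffler_self_pos hα0 hα1 hlam hτ.1).le)).symm
  have hIoi : IntegrableOn f (Ioi 0) :=
    integrableOn_Ioi_of_intervalIntegral_norm_tendsto 1 0 (fun t => (hint 0 t).1) tendsto_id hnorm
  exact tendsto_nhds_unique (intervalIntegral_tendsto_integral_Ioi 0 hIoi tendsto_id) hval
end

section
/- Let (Ω, μ) be a probability space, let ν : Ω → ℕ and J : Ω → ℝ be measurable, and let λ > 0, T > 0, C ≥ 0, M ≥ 0 be constants such that μ({ν = k}) ≤ e^{−λT}(λT)^k/k! for every k ∈ ℕ, and |J(ω)| ≤ C·M^{ν(ω)} for every ω ∈ Ω. Then the second moment of J is finite and satisfies the variance bound ∫_Ω J² dμ ≤ C² · e^{λT(M²−1)}. In particular, if M ≤ 1 the bound C² is uniform in T. -/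
open MeasureTheory

/-- If the law of `ν` is dominated by the Poisson weights of mean `a`, then `∫ c x ^ ν` is bounded by
`c` times the Poisson probability generating function at `x`. -/
lemma lintegral_const_mul_pow_le_of_le_poisson {Ω : Type*} [MeasurableSpace Ω] {μ : Measure Ω}
    {ν : Ω → ℕ} (hν : Measurable ν) {a c x : ℝ} (ha : 0 ≤ a) (hc : 0 ≤ c) (hx : 0 ≤ x)
    (hpois : ∀ k : ℕ, μ {ω | ν ω = k} ≤
      ENNReal.ofReal (Real.exp (-a) * a ^ k / (Nat.factorial k))) :
    ∫⁻ ω, ENNReal.ofReal (c * x ^ ν ω) ∂μ ≤ ENNReal.ofReal (c * Real.exp (a * (x - 1))) := by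
  have hsum : HasSum (fun k : ℕ => c * x ^ k * (Real.exp (-a) * a ^ k / (Nat.factorial k)))
      (c * Real.exp (a * (x - 1))) := by
    have h := (NormedSpace.expSeries_div_hasSum_exp (a * x)).mul_left (c * Real.exp (-a))
    rw [← Real.exp_eq_exp_ℝ, mul_assoc c, ← Real.exp_add] at h
    convert! h using 1
    · funext k
      rw [mul_pow]
      ring
    · ring_nf
  calc ∫⁻ ω, ENNReal.ofReal (c * x ^ ν ω) ∂μ
      = ∫⁻ k, ENNReal.ofReal (c * x ^ k) ∂(μ.map ν) :=
        (lintegral_map (f := fun k : ℕ => ENNReal.ofReal (c * x ^ k))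
          (measurable_of_countable _) hν).symm
    _ = ∑' k : ℕ, ENNReal.ofReal (c * x ^ k) * μ {ω | ν ω = k} := by
        rw [lintegral_countable']
        refine tsum_congr fun k => ?_
        rw [Measure.map_apply hν (measurableSet_singleton k)]
        rfl
    _ ≤ ∑' k : ℕ, ENNReal.ofReal
          (c * x ^ k * (Real.exp (-a) * a ^ k / (Nat.factorial k))) := by
        refine ENNReal.tsum_le_tsum fun k => ?_
        rw [ENNReal.ofReal_mul (p := c * x ^ k) (by positivity)]
        gcongr
        exact hpois k
    _ = ENNReal.ofReal (c * Real.exp (a * (x - 1))) := by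
        rw [← ENNReal.ofReal_tsum_of_nonneg (fun k => by positivity) hsum.summable, hsum.tsum_eq]

/-- Variance bound: if `μ({ν = k}) ≤ e^{−λT}(λT)^k/k!` for all `k` and
`|J| ≤ C·M^ν` pointwise, then `∫ J² dμ ≤ C² e^{λT(M²−1)}`; in particular,
for `M ≤ 1` the bound `C²` is uniform in `T`. -/
theorem variance_bound {Ω : Type*} [MeasurableSpace Ω] (μ : Measure Ω)
    [IsProbabilityMeasure μ] (ν : Ω → ℕ) (J : Ω → ℝ)
    (hν : Measurable ν) (hJ : Measurable J)
    (lam T C M : ℝ) (hlam : 0 < lam) (hT : 0 < T) (hC : 0 ≤ C) (hM : 0 ≤ M)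
    (hpois : ∀ k : ℕ, μ {ω | ν ω = k} ≤
      ENNReal.ofReal (Real.exp (-(lam * T)) * (lam * T) ^ k / (Nat.factorial k)))
    (hbound : ∀ ω, |J ω| ≤ C * M ^ ν ω) :
    Integrable (fun ω => (J ω) ^ 2) μ ∧
    (∫ ω, (J ω) ^ 2 ∂μ) ≤ C ^ 2 * Real.exp (lam * T * (M ^ 2 - 1)) ∧
    (M ≤ 1 → (∫ ω, (J ω) ^ 2 ∂μ) ≤ C ^ 2) := by
  have hlint : ∫⁻ ω, ENNReal.ofReal (J ω ^ 2) ∂μ ≤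
      ENNReal.ofReal (C ^ 2 * Real.exp (lam * T * (M ^ 2 - 1))) := by
    refine (lintegral_mono fun ω => ENNReal.ofReal_le_ofReal ?_).trans
      (lintegral_const_mul_pow_le_of_le_poisson hν (by positivity) (sq_nonneg C)
        (sq_nonneg M) hpois)
    calc J ω ^ 2 = |J ω| ^ 2 := (sq_abs _).symm
      _ ≤ (C * M ^ ν ω) ^ 2 := by gcongr; exact hbound ω
      _ = C ^ 2 * (M ^ 2) ^ ν ω := by ring
  have hmeas : AEStronglyMeasurable (fun ω => J ω ^ 2) μ := (hJ.pow_const 2).aestronglyMeasurable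
  have hnonneg : 0 ≤ᵐ[μ] fun ω => J ω ^ 2 := ae_of_all _ fun ω => sq_nonneg (J ω)
  have hint : ∫ ω, J ω ^ 2 ∂μ ≤ C ^ 2 * Real.exp (lam * T * (M ^ 2 - 1)) := by
    rw [integral_eq_lintegral_of_nonneg_ae hnonneg hmeas]
    exact ENNReal.toReal_le_of_le_ofReal (by positivity) hlint
  refine ⟨⟨hmeas, ?_⟩, hint, fun hM1 => hint.trans (mul_le_of_le_one_right (sq_nonneg C) ?_)⟩
  · rw [hasFiniteIntegral_iff_ofReal hnonneg]
    exact hlint.trans_lt ENNReal.ofReal_lt_top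
  · exact Real.exp_le_one_iff.mpr (mul_nonpos_of_nonneg_of_nonpos (by positivity)
      (sub_nonpos.mpr (pow_le_one₀ hM hM1)))
end

section
/- Let λ > 0, T > 0, and k ∈ ℕ. Let μ be the product of k+1 independent copies of the exponential distribution with rate λ on ℝ (i.e. the product measure on ℝ^{k+1} with each factor having density x ↦ λe^{−λx} on [0,∞)). Then the probability that exactly k renewal epochs occur by time T is Poisson: μ({x ∈ ℝ^{k+1} : x₁ + ⋯ + x_k ≤ T and x₁ + ⋯ + x_{k+1} > T}) = e^{−λT}(λT)^k / k! (where for k = 0 the first condition is vacuous). -/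
open MeasureTheory

/-- The exponential distribution with rate `λ`: the Borel measure on `ℝ` with Lebesgue
density `x ↦ λ e^{−λx}` on `[0,∞)` and `0` on `(−∞,0)`. -/
noncomputable def expDist (lam : ℝ) : Measure ℝ :=
  volume.withDensity
    (fun x : ℝ => ENNReal.ofReal (if 0 ≤ x then lam * Real.exp (-(lam * x)) else 0))

instance (lam : ℝ) : SigmaFinite (expDist lam) := by
  unfold expDist; infer_instance

theorem measurable_expDist_density (lam : ℝ) : Measurable
    (fun x : ℝ => ENNReal.ofReal (if 0 ≤ x then lam * Real.exp (-(lam * x)) else 0)) :=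
  (Measurable.ite measurableSet_Ici (by fun_prop) measurable_const).ennreal_ofReal

/-- The tail of the exponential distribution. -/
theorem expDist_Ioi {lam T : ℝ} (hlam : 0 < lam) (hT : 0 ≤ T) :
    expDist lam (Set.Ioi T) = ENNReal.ofReal (Real.exp (-(lam * T))) := by
  have hint : IntegrableOn (fun x : ℝ => lam * Real.exp (-lam * x)) (Set.Ioi T) :=
    (integrableOn_exp_mul_Ioi (by linarith) T).const_mul lam
  rw [expDist, withDensity_apply _ measurableSet_Ioi,
    setLIntegral_congr_fun (g := fun x => ENNReal.ofReal (lam * Real.exp (-lam * x)))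
      measurableSet_Ioi fun x hx => by
        simp only [if_pos (hT.trans (le_of_lt hx)), neg_mul],
    ← ofReal_integral_eq_lintegral_ofReal hint (.of_forall fun x => by positivity),
    integral_const_mul, integral_exp_mul_Ioi (by linarith)]
  congr 1
  field_simp

/-- The event that exactly `k` renewal epochs occur by time `T`. -/
def renewalEvent (k : ℕ) (T : ℝ) : Set (Fin (k + 1) → ℝ) :=
  {x | ∑ i : Fin k, x i.castSucc ≤ T ∧ T < ∑ i, x i}

theorem measurableSet_renewalEvent (k : ℕ) (T : ℝ) : MeasurableSet (renewalEvent k T) := by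
  have hle : MeasurableSet {x : Fin (k + 1) → ℝ | ∑ i : Fin k, x i.castSucc ≤ T} :=
    measurableSet_le (by fun_prop) measurable_const
  have hlt : MeasurableSet {x : Fin (k + 1) → ℝ | T < ∑ i, x i} :=
    measurableSet_lt measurable_const (by fun_prop)
  exact hle.inter hlt

theorem cons_mem_renewalEvent_iff {k : ℕ} {T a : ℝ} {y : Fin (k + 1) → ℝ} :
    (Fin.cons a y : Fin (k + 2) → ℝ) ∈ renewalEvent (k + 1) T ↔ y ∈ renewalEvent k (T - a) := by
  simp only [renewalEvent, Set.mem_ofPred_eq, Fin.sum_univ_succ (n := k + 1),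
    Fin.sum_univ_succ (n := k) (fun i : Fin (k + 1) => (Fin.cons a y : Fin (k + 2) → ℝ) i.castSucc),
    Fin.castSucc_zero, Fin.cons_zero, Fin.cons_succ, ← Fin.succ_castSucc]
  constructor <;> rintro ⟨h₁, h₂⟩ <;> constructor <;> linarith

/-- Conditioning on the first sojourn time. -/
theorem pi_renewalEvent_succ (lam : ℝ) (k : ℕ) (T : ℝ) :
    Measure.pi (fun _ : Fin (k + 2) => expDist lam) (renewalEvent (k + 1) T) =
      ∫⁻ a, Measure.pi (fun _ : Fin (k + 1) => expDist lam) (renewalEvent k (T - a))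
        ∂(expDist lam) := by
  have hmp := (measurePreserving_piFinSuccAbove (fun _ : Fin (k + 2) => expDist lam) 0).symm
  rw [← hmp.measure_preimage (measurableSet_renewalEvent _ _).nullMeasurableSet,
    Measure.prod_apply (hmp.measurable (measurableSet_renewalEvent _ _))]
  refine lintegral_congr fun a => congrArg _ (Set.ext fun y => ?_)
  rw [← cons_mem_renewalEvent_iff]
  simp [MeasurableEquiv.piFinSuccAbove, Fin.insertNthEquiv]

/-- The real integral behind the recursion for the Poisson probabilities. -/
theorem integral_poisson_recursion (lam T : ℝ) (k : ℕ) :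
    ∫ x in (0 : ℝ)..T, lam * Real.exp (-(lam * T)) * (lam * (T - x)) ^ k / k.factorial =
      Real.exp (-(lam * T)) * (lam * T) ^ (k + 1) / (k + 1).factorial := by
  have hderiv (x : ℝ) : HasDerivAt
      (fun x => -(Real.exp (-(lam * T)) * (lam * (T - x)) ^ (k + 1) / (k + 1).factorial))
      (lam * Real.exp (-(lam * T)) * (lam * (T - x)) ^ k / k.factorial) x := by
    have h := (((((hasDerivAt_id x).const_sub T).const_mul lam).pow (k + 1)).const_mul
      (Real.exp (-(lam * T)))).div_const ((k + 1).factorial : ℝ) |>.neg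
    refine HasDerivAt.congr_deriv h ?_
    simp only [Nat.factorial_succ, Nat.add_sub_cancel, id]
    push_cast
    field_simp
  rw [intervalIntegral.integral_eq_sub_of_hasDerivAt (fun x _ => hderiv x)
    (Continuous.intervalIntegrable (by fun_prop) _ _)]
  simp

theorem pi_renewalEvent {lam : ℝ} (hlam : 0 < lam) (k : ℕ) (T : ℝ) :
    Measure.pi (fun _ : Fin (k + 1) => expDist lam) (renewalEvent k T) =
      if 0 ≤ T then
        ENNReal.ofReal (Real.exp (-(lam * T)) * (lam * T) ^ k / k.factorial)
      else 0 := by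
  induction k generalizing T with
  | zero =>
    split_ifs with hT
    · have hevent : renewalEvent 0 T = Set.univ.pi fun _ => Set.Ioi T := by
        ext x
        simp [renewalEvent, hT]
      simp [hevent, Measure.pi_pi, expDist_Ioi hlam hT]
    · have hevent : renewalEvent 0 T = ∅ := by
        ext x
        simp [renewalEvent, hT]
      simp [hevent]
  | succ k ih =>
    simp_rw [pi_renewalEvent_succ, ih]
    have hmeas : Measurable fun a : ℝ => if 0 ≤ T - a then
        ENNReal.ofReal (Real.exp (-(lam * (T - a))) * (lam * (T - a)) ^ k / k.factorial)
        else 0 :=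
      Measurable.ite (measurableSet_le measurable_const (by fun_prop)) (by fun_prop)
        measurable_const
    rw [expDist, lintegral_withDensity_eq_lintegral_mul _ (measurable_expDist_density lam) hmeas]
    have hprod : ((fun x : ℝ =>
          ENNReal.ofReal (if 0 ≤ x then lam * Real.exp (-(lam * x)) else 0)) *
        fun a : ℝ => if 0 ≤ T - a then
          ENNReal.ofReal (Real.exp (-(lam * (T - a))) * (lam * (T - a)) ^ k / k.factorial)
          else 0) = (Set.Icc 0 T).indicator fun x => ENNReal.ofReal
            (lam * Real.exp (-(lam * T)) * (lam * (T - x)) ^ k / k.factorial) := by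
      ext1 x
      by_cases h₀ : 0 ≤ x <;> by_cases h₁ : x ≤ T <;>
        simp only [Pi.mul_apply, Set.indicator, Set.mem_Icc, sub_nonneg, h₀, h₁, and_true,
          and_false, if_true, if_false, ENNReal.ofReal_zero, zero_mul, mul_zero]
      rw [← ENNReal.ofReal_mul (by positivity)]
      have hexp : Real.exp (-(lam * T)) =
          Real.exp (-(lam * x)) * Real.exp (-(lam * (T - x))) := by
        rw [← Real.exp_add]
        ring_nf
      rw [hexp]
      ring_nf
    rw [hprod, lintegral_indicator measurableSet_Icc]
    split_ifs with hT
    · rw [← integral_poisson_recursion, intervalIntegral.integral_of_le hT,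
        ← integral_Icc_eq_integral_Ioc]
      refine (ofReal_integral_eq_lintegral_ofReal
        (Continuous.integrableOn_Icc (by fun_prop)) ?_).symm
      filter_upwards [ae_restrict_mem measurableSet_Icc] with x hx
      have : 0 ≤ T - x := sub_nonneg.2 hx.2
      positivity
    · simp [Set.Icc_eq_empty hT]

/-- For `k+1` i.i.d. exponential(λ) sojourn times, the probability that exactly `k` renewal
epochs occur by time `T` (i.e. `x₁+⋯+x_k ≤ T < x₁+⋯+x_{k+1}`) is the Poisson probability
`e^{−λT}(λT)^k/k!`. -/
theorem renewal_count_poisson (lam T : ℝ) (hlam : 0 < lam) (hT : 0 < T) (k : ℕ) :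
    (Measure.pi (fun _ : Fin (k + 1) => expDist lam))
      {x : Fin (k + 1) → ℝ |
        (∑ i ∈ Finset.univ.filter (fun i : Fin (k + 1) => (i : ℕ) < k), x i) ≤ T ∧
        T < ∑ i, x i} =
      ENNReal.ofReal (Real.exp (-(lam * T)) * (lam * T) ^ k / (Nat.factorial k)) := by
  have hevent : {x : Fin (k + 1) → ℝ |
      (∑ i ∈ Finset.univ.filter (fun i : Fin (k + 1) => (i : ℕ) < k), x i) ≤ T ∧
      T < ∑ i, x i} = renewalEvent k T := by
    ext x
    simp only [renewalEvent, Set.mem_ofPred_eq, Finset.sum_filter,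
      Fin.sum_univ_castSucc (n := k), Fin.val_castSucc, Fin.is_lt, Fin.val_last, lt_irrefl,
      if_true, if_false, add_zero]
  rw [hevent, pi_renewalEvent hlam, if_pos hT.le]
end
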